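/- arXiv:1810.00227 — 3 statements merged into one kernel-verified Lean document; each statement's English description precedes it below -/
import Mathlib

section
/- Let $p$ be an odd prime and let $k \ge 1$ be an integer with $k \le p-1$ and $p \nmid k$. Then $N(p, S_k) = \frac{1}{2}\left\lfloor \frac{p-1}{k} \right\rfloor - \frac{1}{2}\left(\frac{k}{p}\right) \sum_{m=1}^{\lfloor (p-1)/k \rfloor} \left(\frac{m}{p}\right)$, and consequently $\left| Q(p, S_k) - \frac{1}{2}\left\lfloor \frac{p-1}{k} \right\rfloor \right| \le \frac{1}{2}\sqrt{p}\,\log p$ and $\left| N(p, S_k) - \frac{1}{2}\left\lfloor \frac{p-1}{k} \right\rfloor \right| \le \frac{1}{2}\sqrt{p}\,\log p$. -/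
/-- `a` is a quadratic residue modulo `p`: the congruence `x^2 ≡ a (mod p)` has a solution in `ℤ`. -/
def IsQR (p a : ℕ) : Prop := ∃ x : ℤ, x ^ 2 ≡ (a : ℤ) [ZMOD (p : ℤ)]

open Classical in
/-- `Q(p, S_k)`: the number of quadratic residues modulo `p` in `[1, p-1]` that are multiples of `k`. -/
noncomputable def Qcount (p k : ℕ) : ℕ :=
  ((Finset.Icc 1 (p - 1)).filter fun a => k ∣ a ∧ IsQR p a).card

open Classical in
/-- `N(p, S_k)`: the number of quadratic non-residues modulo `p` in `[1, p-1]` that are multiples of `k`. -/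
noncomputable def Ncount (p k : ℕ) : ℕ :=
  ((Finset.Icc 1 (p - 1)).filter fun a => k ∣ a ∧ ¬ IsQR p a).card

open Classical in
/-- `Q(p, 𝒪)`: the number of quadratic residues modulo `p` among the odd integers in `[1, p-1]`. -/
noncomputable def QcountOdd (p : ℕ) : ℕ :=
  ((Finset.Icc 1 (p - 1)).filter fun a => Odd a ∧ IsQR p a).card

open Classical in
/-- `Q(p, S_2 \ S_4)`: the number of quadratic residues modulo `p` in `[1, p-1]`
divisible by `2` but not by `4`. -/
noncomputable def Qcount2not4 (p : ℕ) : ℕ :=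
  ((Finset.Icc 1 (p - 1)).filter fun a => (2 ∣ a ∧ ¬ (4 ∣ a)) ∧ IsQR p a).card

/-- A geometric sum of a unit complex number `z ≠ 1` is at most `2 / ‖z - 1‖`. -/
theorem norm_geom_sum_Icc_le {z : ℂ} (hz : ‖z‖ = 1) (hz1 : z ≠ 1) (M : ℕ) :
    ‖∑ m ∈ Finset.Icc 1 M, z ^ m‖ ≤ 2 / ‖z - 1‖ := by
  have h : ∑ m ∈ Finset.Icc 1 M, z ^ m = (z ^ (M + 1) - z ^ 1) / (z - 1) := by
    rw [← geom_sum_Ico hz1 (by lia)]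
    rfl
  rw [h, norm_div]
  gcongr
  calc ‖z ^ (M + 1) - z ^ 1‖ ≤ ‖z ^ (M + 1)‖ + ‖z ^ 1‖ := norm_sub_le _ _
    _ = 2 := by simp [hz]; norm_num

/-- The harmonic sum `1 + 1/2 + ⋯ + 1/n` is at most `log (2 n + 1)`. -/
theorem sum_inv_le_log_two_mul_add_one (n : ℕ) :
    ∑ j ∈ Finset.Ico 1 (n + 1), (1 / (j : ℝ)) ≤ Real.log (2 * n + 1) := by
  induction n with
  | zero => simp
  | succ n ih =>
    rw [Finset.sum_Ico_succ_top (by lia)]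
    have hx : (0 : ℝ) ≤ 2 / (2 * n + 1) := by positivity
    have h := Real.le_log_one_add_of_nonneg hx
    have h1 : 2 * (2 / (2 * (n : ℝ) + 1)) / (2 / (2 * n + 1) + 2) = 1 / ((n + 1 : ℕ) : ℝ) := by
      push_cast
      field_simp
      ring
    have h2 : (2 * ((n + 1 : ℕ) : ℝ) + 1) = (2 * n + 1) * (1 + 2 / (2 * n + 1)) := by
      push_cast
      field_simp
      ring
    rw [h2, Real.log_mul (by positivity) (by positivity)]
    linarith

theorem ZMod.sum_univ_eq_sum_range {β : Type*} [AddCommMonoid β] (N : ℕ) [NeZero N]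
    (f : ZMod N → β) : ∑ a, f a = ∑ j ∈ Finset.range N, f (j : ZMod N) := by
  refine Finset.sum_bij' (fun a _ => a.val) (fun j _ => (j : ZMod N)) ?_ ?_ ?_ ?_ ?_
  · exact fun a _ => Finset.mem_range.2 a.val_lt
  · simp
  · simp
  · exact fun j hj => ZMod.val_cast_of_lt (Finset.mem_range.1 hj)
  · simp

theorem ZMod.norm_stdAddChar_natCast_sub_one (N : ℕ) [NeZero N] (j : ℕ) :
    ‖ZMod.stdAddChar (j : ZMod N) - 1‖ = |2 * Real.sin (Real.pi * j / N)| := by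
  have h := ZMod.stdAddChar_coe (N := N) (j : ℤ)
  have h1 : (2 * (Real.pi : ℂ) * Complex.I * ((j : ℤ) : ℂ) / N)
      = Complex.I * ((2 * Real.pi * j / N : ℝ) : ℂ) := by
    push_cast
    ring
  rw [h1] at h
  rw [Int.cast_natCast] at h
  rw [h, Complex.norm_exp_I_mul_ofReal_sub_one, Real.norm_eq_abs]
  congr 3
  ring

theorem ZMod.le_norm_stdAddChar_natCast_sub_one (N : ℕ) [NeZero N] {j : ℕ} (hj : 2 * j ≤ N) :
    4 * (j : ℝ) / N ≤ ‖ZMod.stdAddChar (j : ZMod N) - 1‖ := by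
  rw [ZMod.norm_stdAddChar_natCast_sub_one]
  have hN : (0 : ℝ) < N := by exact_mod_cast Nat.pos_of_neZero N
  have hj' : 2 * (j : ℝ) ≤ N := by exact_mod_cast hj
  have h := Real.mul_le_sin (x := Real.pi * j / N) (by positivity) (by
    rw [div_le_div_iff₀ hN two_pos]
    nlinarith [Real.pi_pos])
  have h1 : 2 / Real.pi * (Real.pi * j / N) = 2 * j / N := by field_simp
  calc 4 * (j : ℝ) / N = 2 * (2 * j / N) := by ring
    _ ≤ 2 * Real.sin (Real.pi * j / N) := by linarith
    _ ≤ _ := le_abs_self _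

theorem ZMod.norm_stdAddChar_neg_sub_one (N : ℕ) [NeZero N] (a : ZMod N) :
    ‖ZMod.stdAddChar (-a) - 1‖ = ‖ZMod.stdAddChar a - 1‖ := by
  have h : ZMod.stdAddChar (-a) - 1 = -(ZMod.stdAddChar (-a) * (ZMod.stdAddChar a - 1)) := by
    rw [mul_sub, ← AddChar.map_add_eq_mul]
    simp
  rw [h, norm_neg, norm_mul, AddChar.norm_apply, one_mul]

/-- For odd `N`, the sum of `2 / ‖e(j/N) - 1‖` over the nonzero residues is at most `N log N`. -/
theorem ZMod.sum_two_div_norm_stdAddChar_sub_one_le {N : ℕ} [NeZero N] (hN : Odd N) :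
    ∑ j ∈ Finset.Ico 1 N, 2 / ‖ZMod.stdAddChar (j : ZMod N) - 1‖ ≤ N * Real.log N := by
  obtain ⟨n, hn⟩ := hN
  have hN0 : (0 : ℝ) < N := by exact_mod_cast Nat.pos_of_neZero N
  have hrefl : ∑ j ∈ Finset.Ico (n + 1) N, 2 / ‖ZMod.stdAddChar (j : ZMod N) - 1‖
      = ∑ j ∈ Finset.Ico 1 (n + 1), 2 / ‖ZMod.stdAddChar (j : ZMod N) - 1‖ := by
    have h := Finset.sum_Ico_reflect
      (fun j : ℕ => 2 / ‖ZMod.stdAddChar (j : ZMod N) - 1‖) 1 (m := n + 1) (n := N) (by lia)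
    rw [show N + 1 - (n + 1) = n + 1 by lia, Nat.add_sub_cancel] at h
    rw [← h]
    refine Finset.sum_congr rfl fun j hj => ?_
    have hj' := Finset.mem_Ico.1 hj
    rw [Nat.cast_sub (by lia), ZMod.natCast_self, zero_sub, ZMod.norm_stdAddChar_neg_sub_one]
  have hhalf : ∑ j ∈ Finset.Ico 1 (n + 1), 2 / ‖ZMod.stdAddChar (j : ZMod N) - 1‖
      ≤ N / 2 * Real.log N := by
    calc _ ≤ ∑ j ∈ Finset.Ico 1 (n + 1), (N : ℝ) / 2 * (1 / (j : ℝ)) := by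
          refine Finset.sum_le_sum fun j hj => ?_
          have hj' := Finset.mem_Ico.1 hj
          have hj0 : (0 : ℝ) < j := by exact_mod_cast hj'.1
          calc _ ≤ 2 / (4 * (j : ℝ) / N) := by
                gcongr
                exact ZMod.le_norm_stdAddChar_natCast_sub_one N (by lia)
            _ = _ := by
                field_simp
                norm_num
      _ = N / 2 * ∑ j ∈ Finset.Ico 1 (n + 1), (1 / (j : ℝ)) := by rw [Finset.mul_sum]
      _ ≤ N / 2 * Real.log (2 * n + 1) := by
          gcongr
          exact sum_inv_le_log_two_mul_add_one n
      _ = N / 2 * Real.log N := by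
          rw [hn]
          push_cast
          rfl
  rw [← Finset.sum_Ico_consecutive _ (show 1 ≤ n + 1 by lia) (show n + 1 ≤ N by lia), hrefl]
  linarith

theorem norm_gaussSum_eq_sqrt_card {F : Type*} [Field F] [Fintype F] {χ : MulChar F ℂ}
    (hχ : χ ≠ 1) {ψ : AddChar F ℂ} (hψ : ψ.IsPrimitive) :
    ‖gaussSum χ ψ‖ = √(Fintype.card F) := by
  have h := gaussSum_mul_gaussSum_eq_card hχ hψ
  rw [← star_gaussSum_eq, Complex.star_def, Complex.mul_conj, Complex.normSq_eq_norm_sq] at h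
  have h' : ‖gaussSum χ ψ‖ ^ 2 = (Fintype.card F : ℝ) := by exact_mod_cast h
  rw [← h', Real.sqrt_sq (norm_nonneg _)]

/-- **Pólya–Vinogradov inequality** for a nontrivial character modulo an odd prime. -/
theorem MulChar.norm_sum_Icc_le_sqrt_mul_log {p : ℕ} [Fact p.Prime] (hp : p ≠ 2)
    {χ : MulChar (ZMod p) ℂ} (hχ : χ ≠ 1) {M : ℕ} (hM : M < p) :
    ‖∑ m ∈ Finset.Icc 1 M, χ (m : ZMod p)‖ ≤ √p * Real.log p := by
  have hpp : p.Prime := Fact.out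
  have hp0 : (0 : ℝ) < p := by exact_mod_cast hpp.pos
  set ψ : AddChar (ZMod p) ℂ := ZMod.stdAddChar with hψ
  have hτ : ‖gaussSum χ⁻¹ ψ‖ = √p := by
    rw [norm_gaussSum_eq_sqrt_card (by simpa using hχ) (ZMod.isPrimitive_stdAddChar p), ZMod.card]
  have hexp : (∑ m ∈ Finset.Icc 1 M, χ (m : ZMod p)) * gaussSum χ⁻¹ ψ
      = ∑ a : ZMod p, χ⁻¹ a * ∑ m ∈ Finset.Icc 1 M, ψ a ^ m := by
    simp_rw [Finset.sum_mul, Finset.mul_sum]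
    rw [Finset.sum_comm]
    refine Finset.sum_congr rfl fun m hm => ?_
    have hm' := Finset.mem_Icc.1 hm
    have hm0 : (m : ZMod p) ≠ 0 := by
      rw [Ne, ZMod.natCast_eq_zero_iff]
      exact Nat.not_dvd_of_pos_of_lt (by lia) (by lia)
    have h := gaussSum_mulShift_eq χ⁻¹ ψ (Units.mk0 _ hm0)
    rw [inv_inv, Units.val_mk0] at h
    rw [← h, gaussSum]
    refine Finset.sum_congr rfl fun a _ => ?_
    rw [AddChar.mulShift_apply, ← AddChar.map_nsmul_eq_pow, nsmul_eq_mul]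
  have hbound : ‖∑ m ∈ Finset.Icc 1 M, χ (m : ZMod p)‖ * √p ≤ p * Real.log p := by
    rw [← hτ, ← norm_mul, hexp, ZMod.sum_univ_eq_sum_range, Finset.range_eq_Ico,
      Finset.sum_eq_sum_Ico_succ_bot hpp.pos, Nat.cast_zero, MulChar.map_zero, zero_mul, zero_add]
    refine (norm_sum_le_of_le _ fun j hj => ?_).trans
      (ZMod.sum_two_div_norm_stdAddChar_sub_one_le (hpp.odd_of_ne_two hp))
    have hj' := Finset.mem_Ico.1 hj
    have hj0 : (j : ZMod p) ≠ 0 := by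
      rw [Ne, ZMod.natCast_eq_zero_iff]
      exact Nat.not_dvd_of_pos_of_lt (by lia) (by lia)
    have hψ1 : ψ (j : ZMod p) ≠ 1 := by
      rw [← AddChar.map_zero_eq_one ψ]
      exact fun h => hj0 (ZMod.injective_stdAddChar h)
    rw [norm_mul]
    have hχ1 : ‖χ⁻¹ (j : ZMod p)‖ ≤ 1 := DirichletCharacter.norm_le_one (χ⁻¹) _
    calc _ ≤ 1 * ‖∑ m ∈ Finset.Icc 1 M, ψ (j : ZMod p) ^ m‖ := by gcongr
      _ ≤ _ := by
        rw [one_mul]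
        exact norm_geom_sum_Icc_le (AddChar.norm_apply _ _) hψ1 M
  have hs : 0 < √(p : ℝ) := Real.sqrt_pos.2 hp0
  refine le_of_mul_le_mul_right (hbound.trans_eq ?_) hs
  rw [mul_right_comm, Real.mul_self_sqrt hp0.le]

theorem abs_sum_Icc_legendreSym_le {p : ℕ} [Fact p.Prime] (hp : p ≠ 2) {M : ℕ} (hM : M < p) :
    |((∑ m ∈ Finset.Icc 1 M, legendreSym p (m : ℤ) : ℤ) : ℝ)| ≤ √p * Real.log p := by
  have hχ : (quadraticChar (ZMod p)).ringHomComp (Int.castRingHom ℂ) ≠ 1 :=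
    (MulChar.ringHomComp_ne_one_iff Int.cast_injective).2
      (quadraticChar_ne_one (by rwa [ZMod.ringChar_zmod_n]))
  have h := MulChar.norm_sum_Icc_le_sqrt_mul_log hp hχ hM
  rw [← Complex.norm_intCast]
  convert h using 2
  simp [legendreSym]

theorem isQR_iff_isSquare (p a : ℕ) : IsQR p a ↔ IsSquare (a : ZMod p) := by
  simp only [IsQR, ← ZMod.intCast_eq_intCast_iff]
  constructor
  · rintro ⟨x, hx⟩
    refine ⟨(x : ZMod p), ?_⟩
    push_cast at hx
    rw [← hx, sq]
  · rintro ⟨y, hy⟩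
    obtain ⟨x, rfl⟩ := ZMod.intCast_surjective y
    refine ⟨x, ?_⟩
    push_cast
    rw [hy, sq]

theorem filter_dvd_Icc_eq_image {k : ℕ} (hk : 1 ≤ k) (n : ℕ) :
    (Finset.Icc 1 n).filter (k ∣ ·) = (Finset.Icc 1 (n / k)).image (k * ·) := by
  ext a
  simp only [Finset.mem_filter, Finset.mem_Icc, Finset.mem_image, Nat.le_div_iff_mul_le hk]
  constructor
  · rintro ⟨⟨h1, h2⟩, m, rfl⟩
    exact ⟨m, ⟨Nat.pos_of_mul_pos_left h1, by rwa [mul_comm]⟩, rfl⟩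
  · rintro ⟨m, ⟨h1, h2⟩, rfl⟩
    exact ⟨⟨Nat.mul_pos hk h1, by rwa [mul_comm]⟩, dvd_mul_right _ _⟩

theorem Qcount_add_Ncount (p : ℕ) {k : ℕ} (hk : 1 ≤ k) :
    Qcount p k + Ncount p k = (p - 1) / k := by
  classical
  have hinj : Function.Injective (k * ·) := fun a b h => Nat.eq_of_mul_eq_mul_left hk h
  have h : ((Finset.Icc 1 (p - 1)).filter (k ∣ ·)).card = (p - 1) / k := by
    rw [filter_dvd_Icc_eq_image hk, Finset.card_image_of_injective _ hinj]
    simp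
  rw [← h, Qcount, Ncount, ← Finset.filter_filter, ← Finset.filter_filter]
  convert Finset.card_filter_add_card_filter_not (s := (Finset.Icc 1 (p - 1)).filter (k ∣ ·))
    (IsQR p)

theorem Qcount_sub_Ncount (p : ℕ) [Fact p.Prime] {k : ℕ} (hk : 1 ≤ k) :
    (Qcount p k : ℤ) - Ncount p k =
      legendreSym p (k : ℤ) * ∑ m ∈ Finset.Icc 1 ((p - 1) / k), legendreSym p (m : ℤ) := by
  classical
  have hinj : Function.Injective (k * ·) := fun a b h => Nat.eq_of_mul_eq_mul_left hk h
  have h : ∑ a ∈ (Finset.Icc 1 (p - 1)).filter (k ∣ ·), legendreSym p (a : ℤ)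
      = legendreSym p (k : ℤ) * ∑ m ∈ Finset.Icc 1 ((p - 1) / k), legendreSym p (m : ℤ) := by
    rw [filter_dvd_Icc_eq_image hk, Finset.sum_image hinj.injOn, Finset.mul_sum]
    refine Finset.sum_congr rfl fun m _ => ?_
    rw [Nat.cast_mul, legendreSym.mul]
  rw [← h, Qcount, Ncount, ← Finset.filter_filter, ← Finset.filter_filter,
    Finset.card_filter, Finset.card_filter]
  push_cast
  rw [← Finset.sum_sub_distrib]
  refine Finset.sum_congr rfl fun a ha => ?_
  have ha' := Finset.mem_Icc.1 (Finset.mem_filter.1 ha).1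
  have ha0 : ((a : ℤ) : ZMod p) ≠ 0 := by
    rw [Int.cast_natCast, Ne, ZMod.natCast_eq_zero_iff]
    exact Nat.not_dvd_of_pos_of_lt (by lia) (by lia)
  by_cases hq : IsQR p a
  · have hl := (legendreSym.eq_one_iff p ha0).2 (by simpa using (isQR_iff_isSquare p a).1 hq)
    simp [hq, hl]
  · have hl := (legendreSym.eq_neg_one_iff p (a := a)).2
      (by simpa using (isQR_iff_isSquare p a).not.1 hq)
    simp [hq, hl]

theorem stmt16 (p k : ℕ) [Fact p.Prime] (hodd : p ≠ 2)
    (hk1 : 1 ≤ k) (hkp : k ≤ p - 1) (hpk : ¬ p ∣ k) :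
    2 * (Ncount p k : ℤ) - ((p - 1) / k : ℕ) =
      - (legendreSym p (k : ℤ) * ∑ m ∈ Finset.Icc 1 ((p - 1) / k), legendreSym p (m : ℤ)) ∧
    |(Qcount p k : ℝ) - (((p - 1) / k : ℕ) : ℝ) / 2| ≤ Real.sqrt p * Real.log p / 2 ∧
    |(Ncount p k : ℝ) - (((p - 1) / k : ℕ) : ℝ) / 2| ≤ Real.sqrt p * Real.log p / 2 := by
  have hadd := Qcount_add_Ncount p hk1
  have hsub := Qcount_sub_Ncount p hk1
  have hMp : (p - 1) / k < p :=
    (Nat.div_le_self _ _).trans_lt (Nat.sub_lt (Fact.out : p.Prime).pos one_pos)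
  have hk0 : ((k : ℤ) : ZMod p) ≠ 0 := by
    rwa [Int.cast_natCast, Ne, ZMod.natCast_eq_zero_iff]
  have hdiff : |(Qcount p k : ℝ) - Ncount p k| ≤ √p * Real.log p := by
    have hsub' : (Qcount p k : ℝ) - Ncount p k = (legendreSym p (k : ℤ) : ℝ) *
        ((∑ m ∈ Finset.Icc 1 ((p - 1) / k), legendreSym p (m : ℤ) : ℤ) : ℝ) := by
      exact_mod_cast hsub
    have hk : |(legendreSym p (k : ℤ) : ℝ)| = 1 := by
      rcases legendreSym.eq_one_or_neg_one p hk0 with h | h <;> simp [h]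
    rw [hsub', abs_mul, hk, one_mul]
    exact abs_sum_Icc_legendreSym_le hodd hMp
  rw [← hsub, ← hadd]
  push_cast
  rw [abs_le] at hdiff ⊢
  rw [abs_le]
  refine ⟨by ring, ⟨?_, ?_⟩, ?_, ?_⟩ <;> linarith [hdiff.1, hdiff.2]
end

section
/- Let $p$ be a prime with $p \equiv 3 \pmod{8}$. Then $\sum_{n=1}^{\lfloor p/4 \rfloor} \left(\frac{n}{p}\right) = 0$, where $\left(\frac{\cdot}{p}\right)$ denotes the Legendre symbol. -/
theorem sum_range_two_mul_eq_sum_even_add_odd (f : ℕ → ℤ) (n : ℕ) :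
    ∑ i ∈ Finset.range (2 * n), f i = ∑ j ∈ Finset.range n, (f (2 * j) + f (2 * j + 1)) := by
  induction n with
  | zero => simp
  | succ n ih =>
    rw [Nat.mul_succ, Finset.sum_range_succ, Finset.sum_range_succ, ih, Finset.sum_range_succ]
    ring

/-- If doubling negates `f` and `f (2 * j + 1) = f (2 * n - 1 - j)`, then splitting the sum of `f`
over `[0, 2 * n)` by parity and into halves shows that the lower half sums to zero. -/
theorem sum_range_eq_zero_of_map_two_mul (f : ℕ → ℤ) (n : ℕ) (heven : ∀ j, f (2 * j) = -f j)
    (hodd : ∀ j < n, f (2 * j + 1) = f (n + (n - 1 - j))) :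
    ∑ i ∈ Finset.range n, f i = 0 := by
  have hparity := sum_range_two_mul_eq_sum_even_add_odd f n
  rw [two_mul n, Finset.sum_range_add, Finset.sum_add_distrib] at hparity
  have heven' : ∑ j ∈ Finset.range n, f (2 * j) = -∑ j ∈ Finset.range n, f j := by
    simp [heven]
  have hodd' : ∑ j ∈ Finset.range n, f (2 * j + 1) = ∑ j ∈ Finset.range n, f (n + j) := by
    rw [← Finset.sum_range_reflect (fun j => f (n + j))]
    exact Finset.sum_congr rfl fun j hj => hodd j (Finset.mem_range.mp hj)
  linarith

theorem legendreSym_two_of_mod_eight_eq_three (p : ℕ) [Fact p.Prime] (h : p % 8 = 3) :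
    legendreSym p 2 = -1 := by
  rw [legendreSym.at_two (by omega), ZMod.χ₈_nat_eq_if_mod_eight, if_neg (by omega),
    if_neg (by omega)]

theorem legendreSym_neg_two_of_mod_eight_eq_three (p : ℕ) [Fact p.Prime] (h : p % 8 = 3) :
    legendreSym p (-2) = 1 := by
  rw [legendreSym.at_neg (by omega), ZMod.χ₄_nat_three_mod_four (by omega),
    legendreSym_two_of_mod_eight_eq_three p h]
  norm_num

theorem stmt18 (p : ℕ) [Fact p.Prime] (h : p % 8 = 3) :
    ∑ n ∈ Finset.Icc 1 (p / 4), legendreSym p (n : ℤ) = 0 := by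
  have hsum : ∑ n ∈ Finset.range (p / 4 + 1), legendreSym p (n : ℤ) = 0 := by
    refine sum_range_eq_zero_of_map_two_mul (fun n => legendreSym p (n : ℤ)) _
      (fun j => ?_) (fun j hj => ?_)
    · rw [Nat.cast_mul, legendreSym.mul, Nat.cast_two, legendreSym_two_of_mod_eight_eq_three p h,
        neg_one_mul]
    · have hcast : ((2 * j + 1 : ℕ) : ℤ)
          = -2 * ((p / 4 + 1 + (p / 4 + 1 - 1 - j) : ℕ) : ℤ) + p := by omega
      rw [hcast, legendreSym.mod, Int.add_emod_right, ← legendreSym.mod, legendreSym.mul,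
        legendreSym_neg_two_of_mod_eight_eq_three p h, one_mul]
  rw [Finset.sum_range_succ', Nat.cast_zero, legendreSym.at_zero, add_zero] at hsum
  rw [← hsum, Finset.range_eq_Ico, Finset.sum_Ico_add' (fun n : ℕ => legendreSym p (n : ℤ))]
  rfl
end

section
/- Let $p$ be a prime with $p \equiv 7 \pmod{8}$. Then $\sum_{n=\lceil p/4 \rceil}^{\lfloor p/2 \rfloor} \left(\frac{n}{p}\right) = 0$, where $\left(\frac{\cdot}{p}\right)$ denotes the Legendre symbol. -/
/-- A sum over `[0, 2N)` splits into its even-indexed and odd-indexed parts. -/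
theorem sum_range_even_add_odd (f : ℕ → ℤ) (N : ℕ) :
    ∑ i ∈ Finset.range (N + N), f i =
      ∑ i ∈ Finset.range N, f (2 * i) + ∑ i ∈ Finset.range N, f (2 * i + 1) := by
  induction N with
  | zero => simp
  | succ N ih =>
    rw [show N + 1 + (N + 1) = N + N + 1 + 1 by ring, Finset.sum_range_succ,
      Finset.sum_range_succ, ih, Finset.sum_range_succ, Finset.sum_range_succ, ← two_mul]
    ring

/-- For `p ≡ 7 [MOD 8]`, doubling preserves the Legendre symbol. -/
theorem legendreSym_two_mul {p : ℕ} [Fact p.Prime] (h : p % 8 = 7) (a : ℤ) :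
    legendreSym p (2 * a) = legendreSym p a := by
  rw [legendreSym.mul, legendreSym.at_two (by rintro rfl; omega), ZMod.χ₈_nat_mod_eight, h,
    show ZMod.χ₈ ((7 : ℕ) : ZMod 8) = 1 by decide, one_mul]

/-- For `p ≡ 7 [MOD 8]`, the Legendre symbol changes sign under `a ↦ p - 2 * a`. -/
theorem legendreSym_sub_two_mul {p : ℕ} [Fact p.Prime] (h : p % 8 = 7) (a : ℤ) :
    legendreSym p (p - 2 * a) = -legendreSym p a := by
  have hneg : legendreSym p (-1) = -1 := by
    rw [legendreSym.at_neg_one (by rintro rfl; omega), ZMod.χ₄_nat_three_mod_four (by omega)]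
  have hmod : legendreSym p (p - 2 * a) = legendreSym p (-1 * (2 * a)) := by
    simp [legendreSym]
  rw [hmod, legendreSym.mul, hneg, legendreSym_two_mul h, neg_one_mul]

theorem stmt19 (p : ℕ) [Fact p.Prime] (h : p % 8 = 7) :
    ∑ n ∈ Finset.Icc ((p + 3) / 4) (p / 2), legendreSym p (n : ℤ) = 0 := by
  obtain ⟨N, hN⟩ : ∃ N, p + 1 = 4 * N := ⟨(p + 1) / 4, by omega⟩
  have hIcc : Finset.Icc ((p + 3) / 4) (p / 2) = Finset.Ico N (N + N) := by
    ext n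
    simp only [Finset.mem_Icc, Finset.mem_Ico]
    omega
  rw [hIcc, Finset.sum_Ico_eq_sum_range, Nat.add_sub_cancel]
  have hsplit := sum_range_even_add_odd (fun n => legendreSym p (n : ℤ)) N
  have hhalves := Finset.sum_range_add (fun n : ℕ => legendreSym p (n : ℤ)) N N
  have heven : ∑ i ∈ Finset.range N, legendreSym p ((2 * i : ℕ) : ℤ) =
      ∑ i ∈ Finset.range N, legendreSym p (i : ℤ) :=
    Finset.sum_congr rfl fun i _ => by
      rw [Nat.cast_mul, Nat.cast_two, legendreSym_two_mul h]
  have hodd : ∑ i ∈ Finset.range N, legendreSym p ((2 * i + 1 : ℕ) : ℤ) =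
      -∑ i ∈ Finset.range N, legendreSym p ((N + i : ℕ) : ℤ) := by
    rw [← Finset.sum_range_reflect (fun i => legendreSym p ((N + i : ℕ) : ℤ)),
      ← Finset.sum_neg_distrib]
    refine Finset.sum_congr rfl fun i hi => ?_
    rw [Finset.mem_range] at hi
    rw [← legendreSym_sub_two_mul h]
    congr 1
    omega
  linarith
end
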